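/- Let σ′ be a minimal coalitional deviation from an NE assignment σ of an m-server load balancing game in which all m servers participate, and let Ã be an arc subset satisfying Assumption 1. Then the map sending each i ∈ W₁ to its unique Ã-out-neighbor is a bijection from W₁ onto W̃₁; moreover W₁ is nonempty, so |W₁| = |W̃₁| > 0. -/

import Mathlib

open scoped Classical

/-- The workload of server `i` under assignment `σ`. -/
def load {n m : ℕ} (p : Fin n → ℝ) (σ : Fin n → Fin m) (i : Fin m) : ℝ :=
  ∑ j ∈ Finset.univ.filter (fun j => σ j = i), p j

/-- `σ` is a Nash equilibrium assignment. -/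
def IsNE {n m : ℕ} (p : Fin n → ℝ) (σ : Fin n → Fin m) : Prop :=
  ∀ j i, load p σ (σ j) ≤ load p σ i + p j

/-- `σ'` is a coalitional deviation from `σ`. -/
def IsDeviation {n m : ℕ} (p : Fin n → ℝ) (σ σ' : Fin n → Fin m) : Prop :=
  (∃ j, σ' j ≠ σ j) ∧ ∀ j, σ' j ≠ σ j → load p σ' (σ' j) < load p σ (σ j)

/-- The improvement ratio of a coalitional deviation. -/
noncomputable def IR {n m : ℕ} (p : Fin n → ℝ) (σ σ' : Fin n → Fin m) : ℝ :=
  sInf {r | ∃ j, σ' j ≠ σ j ∧ r = load p σ (σ j) / load p σ' (σ' j)}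

/-- A coalitional deviation is minimal if every coalitional deviation with a
strictly smaller coalition has a strictly smaller improvement ratio. -/
def IsMinimalDeviation {n m : ℕ} (p : Fin n → ℝ) (σ σ' : Fin n → Fin m) : Prop :=
  IsDeviation p σ σ' ∧
    ∀ σ'' : Fin n → Fin m, IsDeviation p σ σ'' →
      {j | σ'' j ≠ σ j} ⊂ {j | σ' j ≠ σ j} → IR p σ σ'' < IR p σ σ'

/-- Server `i` participates in the deviation: its job set changes. -/
def Participates {n m : ℕ} (σ σ' : Fin n → Fin m) (i : Fin m) : Prop :=
  {j | σ j = i} ≠ {j | σ' j = i}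

/-- `(u,v)` is an arc of the deviation graph. -/
def Arc {n m : ℕ} (σ σ' : Fin n → Fin m) (u v : Fin m) : Prop :=
  ∃ j, σ' j ≠ σ j ∧ σ j = u ∧ σ' j = v

/-- An arc subset `At ⊆ A` is tilde-valid if every server has exactly one
incoming arc in `At`. -/
def TildeValid {n m : ℕ} (σ σ' : Fin n → Fin m) (At : Finset (Fin m × Fin m)) : Prop :=
  (∀ e ∈ At, Arc σ σ' e.1 e.2) ∧
    ∀ i : Fin m, (At.filter (fun e => e.2 = i)).card = 1

/-- The out-degree `b_i` of server `i` in the arc subset `At`. -/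
def outDeg {m : ℕ} (At : Finset (Fin m × Fin m)) (i : Fin m) : ℕ :=
  (At.filter (fun e => e.1 = i)).card

/-- `W₀`: the servers with out-degree `0` in `At`. -/
def W0 {m : ℕ} (At : Finset (Fin m × Fin m)) : Finset (Fin m) :=
  Finset.univ.filter (fun i => outDeg At i = 0)

/-- Server `i` is associated with `W₀`: it is linked to an `A`-out-neighbour of
`W₀` through a sequence of arcs in `At` and `A` in alternation. -/
def AssociatedW0 {n m : ℕ} (σ σ' : Fin n → Fin m)
    (At : Finset (Fin m × Fin m)) (i : Fin m) : Prop :=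
  ∃ (k : ℕ) (is js : ℕ → Fin m),
    i = is k ∧
    (∃ u ∈ W0 At, Arc σ σ' u (js 0)) ∧
    (∀ t ≤ k, (is t, js t) ∈ At) ∧
    (∀ t < k, Arc σ σ' (is t) (js (t + 1)))

/-- `W₁`: the servers associated with `W₀`. -/
noncomputable def W1 {n m : ℕ} (σ σ' : Fin n → Fin m)
    (At : Finset (Fin m × Fin m)) : Finset (Fin m) :=
  Finset.univ.filter (fun i => AssociatedW0 σ σ' At i)

/-- `W̃₁`: the `At`-out-neighbours of `W₁`. -/
noncomputable def W1t {n m : ℕ} (σ σ' : Fin n → Fin m)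
    (At : Finset (Fin m × Fin m)) : Finset (Fin m) :=
  Finset.univ.filter (fun v => ∃ u ∈ W1 σ σ' At, (u, v) ∈ At)

/-- Assumption 1: `At` is tilde-valid and minimizes `|W₀|` among all tilde-valid
arc subsets. -/
def Assumption1 {n m : ℕ} (σ σ' : Fin n → Fin m)
    (At : Finset (Fin m × Fin m)) : Prop :=
  TildeValid σ σ' At ∧
    ∀ At' : Finset (Fin m × Fin m), TildeValid σ σ' At' →
      (W0 At).card ≤ (W0 At').card

/-- An augmenting chain from a vertex `u` outside the range of `g` to a vertex with two preimages
yields a selection of in-neighbours with a strictly larger range. -/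
theorem exists_card_image_lt_of_chain {α : Type*} [Fintype α] [DecidableEq α] {R : α → α → Prop}
    (k : ℕ) : ∀ (g : α → α) (u : α) (js : ℕ → α) (v : α), (∀ i, R (g i) i) →
      (∀ i, g i ≠ u) → R u (js 0) → (∀ t < k, R (g (js t)) (js (t + 1))) →
      v ≠ js k → g v = g (js k) →
      ∃ g' : α → α, (∀ i, R (g' i) i) ∧
        (Finset.univ.image g).card < (Finset.univ.image g').card := by
  induction k using Nat.strong_induction_on with
  | _ k ih =>
    intro g u js v hg hu h0 hchain hv hgv
    by_cases hrep : ∃ t, 0 < t ∧ t ≤ k ∧ js t = js 0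
    · obtain ⟨t, ht0, htk, ht⟩ := hrep
      have hk : t + (k - t) = k := by omega
      refine ih (k - t) (by omega) g u (fun s => js (t + s)) v hg hu (by simpa [ht] using h0)
        (fun s hs => hchain (t + s) (by omega)) ?_ ?_
      · simpa only [hk] using hv
      · simpa only [hk] using hgv
    · push Not at hrep
      set g₁ := Function.update g (js 0) u with hg₁
      have hg₁0 : g₁ (js 0) = u := by simp [hg₁]
      have hg₁ne : ∀ i, i ≠ js 0 → g₁ i = g i := fun i hi => by simp [hg₁, hi]
      have hg₁R : ∀ i, R (g₁ i) i := by
        intro i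
        by_cases hi : i = js 0
        · rw [hi, hg₁0]; exact h0
        · rw [hg₁ne i hi]; exact hg i
      have hu' : u ∉ Finset.univ.image g := by simpa using hu
      have hsub : insert u (Finset.univ.image g) ⊆
          insert (g (js 0)) (Finset.univ.image g₁) := by
        intro x hx
        simp only [Finset.mem_insert, Finset.mem_image, Finset.mem_univ, true_and] at hx ⊢
        rcases hx with rfl | ⟨i, rfl⟩
        · exact Or.inr ⟨_, hg₁0⟩
        · by_cases hi : i = js 0
          · exact Or.inl (by rw [hi])
          · exact Or.inr ⟨i, hg₁ne i hi⟩
      have hcard := Finset.card_le_card hsub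
      rw [Finset.card_insert_of_notMem hu'] at hcard
      by_cases hmem : g (js 0) ∈ Finset.univ.image g₁
      · rw [Finset.insert_eq_of_mem hmem] at hcard
        exact ⟨g₁, hg₁R, hcard⟩
      · rw [Finset.card_insert_of_notMem hmem] at hcard
        have hnot : ∀ i, g₁ i ≠ g (js 0) := by simpa using hmem
        obtain _ | k := k
        · exact absurd ((hg₁ne v hv).trans hgv) (hnot v)
        · have hend : g₁ (js (k + 1)) = g (js (k + 1)) :=
            hg₁ne _ (hrep _ (by omega) le_rfl)
          have hv0 : v ≠ js 0 := by
            rintro rfl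
            exact hnot _ (hend.trans hgv.symm)
          obtain ⟨g', hg', hlt⟩ := ih k (by omega) g₁ (g (js 0)) (fun s => js (s + 1)) v hg₁R
            hnot (hchain 0 (by omega))
            (fun t ht => by
              rw [hg₁ne _ (hrep (t + 1) (by omega) (by omega))]
              exact hchain (t + 1) (by omega))
            hv (by rw [hg₁ne v hv0, hend, hgv])
          exact ⟨g', hg', by omega⟩

/-- A tilde-valid arc subset is the graph of a function selecting the in-neighbours. -/
theorem TildeValid.exists_inNeighbor {n m : ℕ} {σ σ' : Fin n → Fin m}
    {At : Finset (Fin m × Fin m)} (h : TildeValid σ σ' At) :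
    ∃ g : Fin m → Fin m, ∀ u v, (u, v) ∈ At ↔ g v = u := by
  have key : ∀ v, ∃ u, ∀ w, (w, v) ∈ At ↔ u = w := by
    intro v
    obtain ⟨⟨a, b⟩, he⟩ := Finset.card_eq_one.mp (h.2 v)
    have hmem : ∀ w x, ((w, x) ∈ At ∧ x = v) ↔ (w = a ∧ x = b) := by
      intro w x
      have := Finset.ext_iff.mp he (w, x)
      simpa using this
    have hb : b = v := ((hmem a b).mpr ⟨rfl, rfl⟩).2
    refine ⟨a, fun w => ?_⟩
    have := hmem w v
    simp only [hb, and_true] at this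
    rw [this, eq_comm]
  choose g hg using key
  exact ⟨g, fun u v => hg v u⟩

theorem mem_W0_iff {m : ℕ} {At : Finset (Fin m × Fin m)} {g : Fin m → Fin m}
    (hg : ∀ u v, (u, v) ∈ At ↔ g v = u) (i : Fin m) : i ∈ W0 At ↔ ∀ v, g v ≠ i := by
  simp only [W0, outDeg, Finset.mem_filter, Finset.mem_univ, true_and, Finset.card_eq_zero,
    Finset.filter_eq_empty_iff, Prod.forall]
  constructor
  · exact fun h v hv => h i v ((hg i v).mpr hv) rfl
  · rintro h a b hab rfl
    exact h b ((hg a b).mp hab)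

theorem card_W0_add_card_image {m : ℕ} {At : Finset (Fin m × Fin m)} {g : Fin m → Fin m}
    (hg : ∀ u v, (u, v) ∈ At ↔ g v = u) :
    (W0 At).card + (Finset.univ.image g).card = m := by
  have h : W0 At = (Finset.univ.image g)ᶜ := by
    ext i
    simp [mem_W0_iff hg]
  rw [h, Finset.card_compl_add_card, Fintype.card_fin]

/-- Under Assumption 1 the selection of in-neighbours has the largest possible range. -/
theorem Assumption1.card_image_le {n m : ℕ} {σ σ' : Fin n → Fin m}
    {At : Finset (Fin m × Fin m)} (hA : Assumption1 σ σ' At) {g g' : Fin m → Fin m}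
    (hg : ∀ u v, (u, v) ∈ At ↔ g v = u) (hg' : ∀ v, Arc σ σ' (g' v) v) :
    (Finset.univ.image g').card ≤ (Finset.univ.image g).card := by
  set At' : Finset (Fin m × Fin m) := Finset.univ.filter (fun e => g' e.2 = e.1) with hAt'
  have hmem : ∀ u v, (u, v) ∈ At' ↔ g' v = u := fun u v => by simp [hAt']
  have hvalid : TildeValid σ σ' At' := by
    refine ⟨?_, fun v => Finset.card_eq_one.mpr ⟨(g' v, v), ?_⟩⟩
    · rintro ⟨u, v⟩ he
      obtain rfl := (hmem u v).mp he
      exact hg' v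
    · ext ⟨a, b⟩
      simp only [Finset.mem_filter, hmem, Finset.mem_singleton, Prod.mk.injEq]
      constructor
      · rintro ⟨rfl, rfl⟩; exact ⟨rfl, rfl⟩
      · rintro ⟨rfl, rfl⟩; exact ⟨rfl, rfl⟩
  have h₁ := hA.2 At' hvalid
  have h₂ := card_W0_add_card_image hg
  have h₃ := card_W0_add_card_image hmem
  omega

theorem sum_load {n m : ℕ} (p : Fin n → ℝ) (σ : Fin n → Fin m) :
    ∑ i, load p σ i = ∑ j, p j :=
  Finset.sum_fiberwise _ _ _

/-- Arcs of a coalitional deviation cannot contain a permutation of all servers. -/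
theorem IsDeviation.not_surjective {n m : ℕ} {p : Fin n → ℝ} {σ σ' : Fin n → Fin m}
    (hdev : IsDeviation p σ σ') {g : Fin m → Fin m} (hg : ∀ v, Arc σ σ' (g v) v) :
    ¬ Function.Surjective g := by
  intro hsurj
  obtain ⟨j, -⟩ := hdev.1
  have hlt : ∑ v, load p σ' v < ∑ v, load p σ (g v) := by
    refine Finset.sum_lt_sum_of_nonempty ⟨σ j, Finset.mem_univ _⟩ fun v _ => ?_
    obtain ⟨j, hj, hju, hjv⟩ := hg v
    have := hdev.2 j hj
    rwa [hju, hjv] at this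
  rw [(Finite.injective_iff_surjective.mpr hsurj |>.bijective_of_finite).sum_comp (load p σ),
    sum_load, sum_load] at hlt
  exact lt_irrefl _ hlt

/-- In a coalitional deviation from a Nash equilibrium, some job leaves every participating
server. -/
theorem IsNE.exists_arc_of_participates {n m : ℕ} {p : Fin n → ℝ} (hp : ∀ j, 0 < p j)
    {σ σ' : Fin n → Fin m} (hNE : IsNE p σ) (hdev : IsDeviation p σ σ') {u : Fin m}
    (hu : Participates σ σ' u) : ∃ v, Arc σ σ' u v := by
  by_contra! hno
  have hstay : ∀ j, σ j = u → σ' j = u := by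
    intro j hj
    by_contra hne
    exact hno (σ' j) ⟨j, by rwa [hj], hj, rfl⟩
  obtain ⟨j, hj', hj⟩ : ∃ j, σ' j = u ∧ σ j ≠ u := by
    by_contra! h
    exact hu (Set.ext fun j => ⟨hstay j, h j⟩)
  have hlt := hdev.2 j (by rw [hj']; exact hj.symm)
  have hle := hNE j u
  have hload : load p σ u + p j ≤ load p σ' u := by
    have hnot : j ∉ Finset.univ.filter (fun j => σ j = u) := by simpa using hj
    rw [load, load, add_comm, ← Finset.sum_insert hnot]
    refine Finset.sum_le_sum_of_subset_of_nonneg ?_ fun i _ _ => (hp i).le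
    intro i hi
    simp only [Finset.mem_insert, Finset.mem_filter, Finset.mem_univ, true_and] at hi ⊢
    rcases hi with rfl | hi
    · exact hj'
    · exact hstay i hi
  rw [hj'] at hlt
  linarith

/-- For a minimal coalitional deviation from an NE involving all `m` servers
and an arc subset `At` satisfying Assumption 1: the map sending each node of
`W₁` to its unique `At`-out-neighbour is a bijection from `W₁` onto `W̃₁`;
moreover `W₁` is nonempty, so `|W₁| = |W̃₁| > 0`. -/
theorem W1_bijects_onto_W1t {n m : ℕ}
    (p : Fin n → ℝ) (hp : ∀ j, 0 < p j)
    (σ : Fin n → Fin m) (hNE : IsNE p σ)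
    (σ' : Fin n → Fin m) (hmin : IsMinimalDeviation p σ σ')
    (hall : ∀ i, Participates σ σ' i)
    (At : Finset (Fin m × Fin m)) (hA : Assumption1 σ σ' At) :
    (∃ f : Fin m → Fin m, (∀ i ∈ W1 σ σ' At, (i, f i) ∈ At) ∧
        Set.BijOn f ↑(W1 σ σ' At) ↑(W1t σ σ' At)) ∧
      (W1 σ σ' At).Nonempty ∧
      (W1 σ σ' At).card = (W1t σ σ' At).card ∧
      0 < (W1 σ σ' At).card := by
  obtain ⟨g, hg⟩ := hA.1.exists_inNeighbor
  have hgArc : ∀ v, Arc σ σ' (g v) v := fun v => hA.1.1 _ ((hg (g v) v).mpr rfl)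
  have hout : ∀ i ∈ W1 σ σ' At, ∃ v, (i, v) ∈ At ∧ ∀ w, (i, w) ∈ At → w = v := by
    intro i hi
    obtain ⟨k, is, js, rfl, ⟨u, hu, hu0⟩, hAt, hArc⟩ := (Finset.mem_filter.mp hi).2
    refine ⟨js k, hAt k le_rfl, fun w hw => ?_⟩
    by_contra hne
    obtain ⟨g', hg', hlt⟩ := exists_card_image_lt_of_chain (R := Arc σ σ') k g u js w hgArc
      ((mem_W0_iff hg u).mp hu) hu0
      (fun t ht => by rw [(hg _ _).mp (hAt t ht.le)]; exact hArc t ht) hne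
      (((hg _ _).mp hw).trans ((hg _ _).mp (hAt k le_rfl)).symm)
    exact (hA.card_image_le hg hg').not_gt hlt
  have hne : (W1 σ σ' At).Nonempty := by
    obtain ⟨u, hu⟩ : ∃ u, ∀ v, g v ≠ u := by
      simpa [Function.Surjective] using hmin.1.not_surjective hgArc
    obtain ⟨v, huv⟩ := hNE.exists_arc_of_participates hp hmin.1 (hall u)
    exact ⟨g v, Finset.mem_filter.mpr ⟨Finset.mem_univ _, 0, fun _ => g v, fun _ => v, rfl,
      ⟨u, (mem_W0_iff hg u).mpr hu, huv⟩, fun _ _ => (hg _ _).mpr rfl, by simp⟩⟩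
  choose! f hf hfuniq using hout
  have hbij : Set.BijOn f ↑(W1 σ σ' At) ↑(W1t σ σ' At) := by
    refine ⟨fun i hi => ?_, fun i hi i' hi' h => ?_, fun v hv => ?_⟩
    · exact Finset.mem_coe.mpr (Finset.mem_filter.mpr ⟨Finset.mem_univ _, i, hi, hf i hi⟩)
    · rw [← (hg _ _).mp (hf i hi), ← (hg _ _).mp (hf i' hi'), h]
    · obtain ⟨-, u, hu, huv⟩ := Finset.mem_filter.mp (Finset.mem_coe.mp hv)
      exact ⟨u, hu, (hfuniq u hu v huv).symm⟩
  exact ⟨⟨f, hf, hbij⟩, hne, Finset.card_nbij f hbij.mapsTo hbij.injOn hbij.surjOn,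
    hne.card_pos⟩
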